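/- arXiv:1502.06840 — 2 statements merged into one kernel-verified Lean document; each statement's English description precedes it below -/
import Mathlib

section
/- Let H be a finite abelian group. Then the size of any family of subgroups of H in general position is at most m(H). -/
/-- A sequence `(g 0, …, g (n-1))` of elements of a group `G` is *irredundant* if for every
`i`, the subgroup generated by the `g j` with `j ≠ i` is properly contained in the subgroup
generated by all the `g j`. -/
def Irredundant {G : Type*} [Group G] {n : ℕ} (g : Fin n → G) : Prop :=
  ∀ i : Fin n, Subgroup.closure (g '' {j | j ≠ i}) < Subgroup.closure (Set.range g)

/-- `mInv G` is the maximum size of an irredundant generating sequence of `G`. -/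
noncomputable def mInv (G : Type*) [Group G] : ℕ :=
  sSup {n | ∃ g : Fin n → G, Irredundant g ∧ Subgroup.closure (Set.range g) = ⊤}

/-- A family of subgroups `H i` of `G` is in *general position* if for every index `i`,
the intersection of the `H j` with `j ≠ i` properly contains the intersection of all the
`H j`. -/
def GeneralPosition {G : Type*} [Group G] {ι : Type*} (H : ι → Subgroup G) : Prop :=
  ∀ i : ι, (⨅ j, H j) < ⨅ j ∈ ({i}ᶜ : Set ι), H j

/-- `mdInv G` is the maximum size of a family of maximal subgroups of `G` in general
position. -/
noncomputable def mdInv (G : Type*) [Group G] : ℕ :=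
  sSup {n | ∃ M : Fin n → Subgroup G, (∀ i, IsCoatom (M i)) ∧ GeneralPosition M}

theorem exists_separating_element_of_notMem {G : Type*} [CommGroup G] [Finite G]
    (Φ : Subgroup (G →* ℂˣ)) {φ : G →* ℂˣ} (hφ : φ ∉ Φ) :
    ∃ g : G, (∀ ψ ∈ Φ, ψ g = 1) ∧ φ g ≠ 1 := by
  by_contra! h
  let O := CommGroup.subgroupOrderIsoSubgroupMonoidHom G ℂ
  apply hφ
  have hO : OrderDual.ofDual (O (O.symm (OrderDual.toDual Φ))) = Φ := by simp
  rw [← hO, CommGroup.mem_subgroupOrderIsoSubgroupMonoidHom_iff]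
  intro g hg
  rw [CommGroup.mem_subgroupOrderIsoSubgroupMonoidHom_symm_iff] at hg
  exact h g hg

theorem exists_pow_mem_of_notMem {H : Type*} [CommGroup H] [Finite H] (A : Subgroup H) {x : H}
    (hx : x ∉ A) : ∃ k p : ℕ, p.Prime ∧ x ^ k ∉ A ∧ (x ^ k) ^ p ∈ A := by
  have hpow (k : ℕ) : x ^ k ∈ A ↔ orderOf (x : H ⧸ A) ∣ k := by
    rw [orderOf_dvd_iff_pow_eq_one, ← QuotientGroup.mk_pow, QuotientGroup.eq_one_iff]
  have hm : orderOf (x : H ⧸ A) ≠ 1 := by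
    rwa [Ne, orderOf_eq_one_iff, QuotientGroup.eq_one_iff]
  have hpos := orderOf_pos (x : H ⧸ A)
  have hp := Nat.minFac_prime hm
  refine ⟨orderOf (x : H ⧸ A) / (orderOf (x : H ⧸ A)).minFac, _, hp, ?_, ?_⟩
  · rw [hpow]
    exact Nat.not_dvd_of_pos_of_lt (Nat.div_pos (Nat.minFac_le hpos) hp.pos)
      (Nat.div_lt_self hpos hp.one_lt)
  · rw [← pow_mul, hpow, Nat.div_mul_cancel (Nat.minFac_dvd _)]

theorem Irredundant.injective {G : Type*} [Group G] {n : ℕ} {g : Fin n → G}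
    (hg : Irredundant g) : Function.Injective g := by
  intro i j hij
  by_contra hne
  refine (hg i).not_ge ((Subgroup.closure_le _).2 ?_)
  rintro _ ⟨k, rfl⟩
  apply Subgroup.subset_closure
  by_cases hk : k = i
  · exact ⟨j, fun h => hne h.symm, by rw [hk, hij]⟩
  · exact ⟨k, hk, rfl⟩

theorem ncard_le_mInv_of_minimal {G : Type*} [Group G] [Finite G] {T : Set G}
    (hT : Subgroup.closure T = ⊤) (hmin : ∀ t ∈ T, Subgroup.closure (T \ {t}) ≠ ⊤) :
    T.ncard ≤ mInv G := by
  refine le_csSup ⟨Nat.card G, ?_⟩ ?_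
  · rintro n ⟨g, hg, -⟩
    simpa using Nat.card_le_card_of_injective g hg.injective
  · let e : Fin T.ncard ≃ T := (Finite.equivFin T).symm
    have hrange : Set.range (fun i => (e i : G)) = T := by
      rw [← Function.comp_def, Set.range_comp, e.range_eq_univ]
      simp
    refine ⟨fun i => e i, fun i => ?_, by rw [hrange, hT]⟩
    rw [hrange, hT, lt_top_iff_ne_top]
    convert hmin (e i) (e i).2
    ext t
    constructor
    · rintro ⟨j, hj, rfl⟩
      exact ⟨(e j).2, fun h => hj (e.injective (Subtype.ext h))⟩
    · rintro ⟨ht, hne⟩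
      refine ⟨e.symm ⟨t, ht⟩, fun h => hne ?_, by simp⟩
      simp [← h]

theorem card_le_mInv_of_dual_characters {H : Type*} [CommGroup H] [Finite H] {n : ℕ}
    (f : Fin n → H →* ℂˣ) (y : Fin n → H) (p : Fin n → ℕ) (hp : ∀ i, (p i).Prime)
    (hf : ∀ i, f i ^ p i = 1) (hy : ∀ i, f i (y i) ≠ 1) (hfy : ∀ i j, j ≠ i → f i (y j) = 1) :
    n ≤ mInv H := by
  have hgen : Subgroup.closure (Set.range y ∪ {h | ∀ i, f i h = 1}) = ⊤ := by
    rw [eq_top_iff]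
    intro h _
    have hk (i) : ∃ k : ℕ, f i (y i) ^ k = f i h := by
      have hpow (a : H) : f i a ^ p i = 1 := DFunLike.congr_fun (hf i) a
      have := Fact.mk (hp i)
      have hprim := IsPrimitiveRoot.iff_orderOf.2 (orderOf_eq_prime (hpow (y i)) (hy i))
      have : NeZero (p i) := ⟨(hp i).ne_zero⟩
      have hprim' := IsPrimitiveRoot.coe_units_iff.2 hprim
      obtain ⟨k, -, hk⟩ := hprim'.eq_pow_of_pow_eq_one (ξ := (f i h : ℂ))
        (by rw [← Units.val_pow_eq_pow_val, hpow, Units.val_one])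
      exact ⟨k, by exact_mod_cast hk⟩
    choose k hk using hk
    rw [← inv_mul_cancel_right h (∏ i, y i ^ k i)]
    refine mul_mem (Subgroup.subset_closure (Or.inr fun i => ?_))
      (Subgroup.prod_mem _ fun i _ => Subgroup.pow_mem _
        (Subgroup.subset_closure (Set.mem_union_left _ (Set.mem_range_self i))) _)
    rw [map_mul, map_inv, map_prod, Finset.prod_eq_single i, map_pow, hk, mul_inv_cancel]
    · intro j _ hj
      rw [map_pow, hfy i j hj, one_pow]
    · simp
  obtain ⟨T, hTS, hT⟩ := exists_minimal_le_of_wellFoundedLT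
    (fun T : Set H => Subgroup.closure T = ⊤) _ hgen
  have hyT (i) : y i ∈ T := by
    by_contra hi
    have hle : Subgroup.closure T ≤ (f i).ker := by
      rw [Subgroup.closure_le]
      intro t ht
      rcases hTS ht with ⟨j, rfl⟩ | h
      · exact hfy i j (by rintro rfl; exact hi ht)
      · exact h i
    rw [hT.prop] at hle
    exact hy i (hle (Subgroup.mem_top (y i)))
  have hinj : Function.Injective y := by
    intro i j hij
    by_contra hne
    exact hy i (hij ▸ hfy i j (Ne.symm hne))
  calc n = (Set.range y).ncard := by
        rw [← Set.image_univ, Set.ncard_image_of_injective _ hinj]; simp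
    _ ≤ T.ncard := Set.ncard_le_ncard (Set.range_subset_iff.2 hyT)
    _ ≤ mInv H := ncard_le_mInv_of_minimal hT.prop fun t ht h =>
        (hT.le_of_le h Set.sdiff_subset ht).2 rfl

/-- For a finite abelian group `H`, the size of any family of subgroups of `H` in general
position is at most `m(H)`. -/
theorem card_le_m_of_generalPosition_abelian (H : Type*) [CommGroup H] [Finite H]
    (n : ℕ) (A : Fin n → Subgroup H) (hA : GeneralPosition A) : n ≤ mInv H := by
  have hx (i) : ∃ x p, Nat.Prime p ∧ x ∉ A i ∧ x ^ p ∈ A i ∧ ∀ j, j ≠ i → x ∈ A j := by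
    obtain ⟨x, hx, hxA⟩ := SetLike.exists_of_lt (hA i)
    simp only [Subgroup.mem_iInf, Set.mem_compl_iff, Set.mem_singleton_iff] at hx hxA
    have hxi : x ∉ A i := fun h => hxA fun j => by
      by_cases hj : j = i
      · exact hj ▸ h
      · exact hx j hj
    obtain ⟨k, p, hp, hk, hkp⟩ := exists_pow_mem_of_notMem (A i) hxi
    exact ⟨x ^ k, p, hp, hk, hkp, fun j hj => pow_mem (hx j hj) k⟩
  choose x p hp hxi hxp hxj using hx
  let B : Subgroup H := ⨅ i, A i
  obtain ⟨e⟩ := CommGroup.monoidHom_mulEquiv_of_hasEnoughRootsOfUnity (H ⧸ B) ℂ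
  let χ (i : Fin n) : H ⧸ B →* ℂˣ := e.symm (x i : H ⧸ B)
  let K (i : Fin n) : Subgroup (H ⧸ B →* ℂˣ) :=
    ((A i).map (QuotientGroup.mk' B)).comap e.toMonoidHom
  have hK (i j) : χ j ∈ K i ↔ x j ∈ A i := by
    have h : χ j ∈ K i ↔ x j ∈ ((A i).map (QuotientGroup.mk' B)).comap (QuotientGroup.mk' B) := by
      simp only [χ, K, Subgroup.mem_comap, MulEquiv.toMonoidHom_eq_coe, MonoidHom.coe_coe,
        MulEquiv.apply_symm_apply, QuotientGroup.mk'_apply]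
    rw [h, Subgroup.comap_map_eq_self]
    rw [QuotientGroup.ker_mk']
    exact iInf_le _ _
  have hχ (i) : χ i ^ p i = 1 := by
    change e.symm _ ^ p i = 1
    rw [← map_pow, ← QuotientGroup.mk_pow, (QuotientGroup.eq_one_iff _).2, map_one]
    rw [Subgroup.mem_iInf]
    intro j
    by_cases hj : j = i
    · exact hj ▸ hxp i
    · exact pow_mem (hxj i j hj) _
  choose g hg hgi using fun i =>
    exists_separating_element_of_notMem (K i) (mt (hK i i).1 (hxi i))
  choose y hy using fun i => QuotientGroup.mk'_surjective B (g i)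
  refine card_le_mInv_of_dual_characters (fun i => (χ i).comp (QuotientGroup.mk' B)) y p hp
    (fun i => ?_) (fun i => ?_) (fun i j hj => ?_)
  · ext h
    simpa using congrArg Units.val (DFunLike.congr_fun (hχ i) (h : H ⧸ B))
  · simpa only [MonoidHom.comp_apply, hy] using hgi i
  · simpa only [MonoidHom.comp_apply, hy] using
      hg j (χ i) ((hK j i).2 (hxj i j hj))
end

section
/- Let p and q be primes with p dividing q − 1 and let G_{q,p} = V ⋊ H be as defined. Then i(G_{q,p}) = 2p. -/
/-- `V = F_q^p`, the `p`-dimensional vector space over the field with `q` elements. -/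
abbrev Vqp (q p : ℕ) : Type := Fin p → ZMod q

/-- The permutation of `V = F_q^p` multiplying the `i`-th coordinate by the unit `c`. -/
def scalePerm (q p : ℕ) [Fact q.Prime] (c : (ZMod q)ˣ) (i : Fin p) : Equiv.Perm (Vqp q p) :=
  Equiv.piCongrRight fun j =>
    if j = i then Equiv.mulLeft₀ (c : ZMod q) c.ne_zero else Equiv.refl _

/-- The permutation of `V = F_q^p` induced by a permutation `e` of the coordinates:
`(f_1, …, f_p) ↦ (f_{1 e⁻¹}, …, f_{p e⁻¹})`. -/
def coordPerm (q p : ℕ) (e : Equiv.Perm (Fin p)) : Equiv.Perm (Vqp q p) :=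
  Equiv.arrowCongr e (Equiv.refl (ZMod q))

/-- The wreath product `H = C ≀ ⟨σ⟩` realized inside `Perm V`: the subgroup generated by the
scalings by `c` at each coordinate (which generate the base group `C^p`) together with the
cyclic coordinate permutation `σ = (1 2 … p)`.  Here `C = ⟨c⟩` is the subgroup of order `p`
of `F_q^*`. -/
def Hqp (q p : ℕ) [Fact q.Prime] (c : (ZMod q)ˣ) : Subgroup (Equiv.Perm (Vqp q p)) :=
  Subgroup.closure (Set.range (scalePerm q p c) ∪ {coordPerm q p (finRotate p)})

/-- The group of translations of `V`, realized inside `Perm V`. -/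
def Vtrans (q p : ℕ) : Subgroup (Equiv.Perm (Vqp q p)) :=
  Subgroup.closure (Set.range fun v : Vqp q p => Equiv.addLeft v)

/-- `G_{q,p} = V ⋊ H`, realized as the group of permutations of `V` of the form
`x ↦ x^h + v` with `h ∈ H`, `v ∈ V` (the action of `V ⋊ H` on `V` is faithful). -/
def Gqp (q p : ℕ) [Fact q.Prime] (c : (ZMod q)ˣ) : Subgroup (Equiv.Perm (Vqp q p)) :=
  Vtrans q p ⊔ Hqp q p c

/-- `iInv G` is the maximum size of an irredundant sequence of elements of `G`. -/
noncomputable def iInv (G : Type*) [Group G] : ℕ :=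
  sSup {n | ∃ g : Fin n → G, Irredundant g}

open ArithmeticFunction

/-- Among divisors of a nonzero number, `Ω` is strictly monotone. -/
theorem cardFactors_lt_of_dvd_of_ne {a b : ℕ} (hb : b ≠ 0) (h : a ∣ b) (hab : a ≠ b) :
    cardFactors a < cardFactors b := by
  obtain ⟨k, rfl⟩ := h
  have ha : a ≠ 0 := left_ne_zero_of_mul hb
  have hk : k ≠ 0 := right_ne_zero_of_mul hb
  have hk1 : cardFactors k ≠ 0 := by
    rw [Ne, cardFactors_eq_zero_iff_eq_zero_or_one]
    rintro (rfl | rfl) <;> simp_all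
  rw [cardFactors_mul ha hk]
  omega

theorem cardFactors_le_of_dvd {a b : ℕ} (hb : b ≠ 0) (h : a ∣ b) :
    cardFactors a ≤ cardFactors b := by
  rcases eq_or_ne a b with rfl | hab
  · exact le_rfl
  · exact (cardFactors_lt_of_dvd_of_ne hb h hab).le

section Irredundance

variable {G : Type*} [Group G]

theorem irredundant_iff_notMem {n : ℕ} {g : Fin n → G} :
    Irredundant g ↔ ∀ i, g i ∉ Subgroup.closure (g '' {j | j ≠ i}) := by
  refine forall_congr' fun i => ⟨fun h hi => h.not_ge ?_, fun h => ?_⟩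
  · rw [Subgroup.closure_le]
    rintro _ ⟨j, rfl⟩
    by_cases hj : j = i
    · exact hj ▸ hi
    · exact Subgroup.subset_closure ⟨j, hj, rfl⟩
  · refine lt_of_le_of_ne (Subgroup.closure_mono (Set.image_subset_range _ _)) fun he => h ?_
    rw [he]
    exact Subgroup.subset_closure ⟨i, rfl⟩

/-- A finite irredundant family has at most `Ω(|⟨g⟩|)` members. -/
theorem card_le_cardFactors_closure [Finite G] {ι : Type*} (g : ι → G)
    (s : Finset ι) (hg : ∀ i ∈ s, g i ∉ Subgroup.closure (g '' {j | j ∈ s ∧ j ≠ i})) :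
    s.card ≤ cardFactors (Nat.card (Subgroup.closure (g '' s))) := by
  classical
  induction s using Finset.induction_on with
  | empty => simp
  | insert a s ha ih =>
    have ih' := ih fun i hi h => hg i (Finset.mem_insert_of_mem hi)
      (Subgroup.closure_mono (Set.image_mono fun _ => And.imp_left Finset.mem_insert_of_mem) h)
    have hlt : Subgroup.closure (g '' s) < Subgroup.closure (g '' (insert a s : Finset ι)) := by
      refine lt_of_le_of_ne (Subgroup.closure_mono (Set.image_mono (by simp))) fun he => ?_
      have hsub : (s : Set ι) ⊆ {j | j ∈ insert a s ∧ j ≠ a} := fun j hj =>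
        ⟨Finset.mem_insert_of_mem hj, fun h => ha (h ▸ hj)⟩
      refine hg a (Finset.mem_insert_self a s)
        (Subgroup.closure_mono (Set.image_mono hsub) ?_)
      rw [he]
      exact Subgroup.subset_closure ⟨a, by simp, rfl⟩
    have := cardFactors_lt_of_dvd_of_ne Nat.card_pos.ne' (Subgroup.card_dvd_of_le hlt.le)
      fun h => hlt.ne (Subgroup.eq_of_le_of_card_ge hlt.le h.ge)
    rw [Finset.card_insert_of_notMem ha]
    omega

/-- If `Ω(|G|) ≤ m` and every subgroup of prime index of `G` contains a normal subgroup `N` with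
`Ω(|G / N|) < m`, then every irredundant sequence in `G` has fewer than `m` elements. -/
theorem Irredundant.lt_of_prime_index [Finite G] {m n : ℕ} {N : Subgroup G} [N.Normal]
    (hG : cardFactors (Nat.card G) ≤ m) (hN : cardFactors N.index < m)
    (hM : ∀ M : Subgroup G, M.index.Prime → N ≤ M) {g : Fin n → G} (hg : Irredundant g) :
    n < m := by
  rw [irredundant_iff_notMem] at hg
  by_contra! hmn
  have key (i : Fin n) : N ≤ Subgroup.closure (g '' {j | j ≠ i}) := by
    set M := Subgroup.closure (g '' {j | j ≠ i})
    apply hM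
    have h1 := card_le_cardFactors_closure g (Finset.univ.erase i) fun k _ hmem =>
      hg k (Subgroup.closure_mono (Set.image_mono fun j hj => hj.2) hmem)
    have hMe : Subgroup.closure (g '' (Finset.univ.erase i : Finset (Fin n))) = M := by
      congr 2
      ext j
      simp
    rw [hMe, Finset.card_erase_of_mem (Finset.mem_univ i), Finset.card_univ,
      Fintype.card_fin] at h1
    have h2 : M.index ≠ 1 := fun h => hg i (by
      change g i ∈ M
      rw [Subgroup.index_eq_one.mp h]
      trivial)
    have h3 : cardFactors M.index ≠ 0 := by
      rw [Ne, cardFactors_eq_zero_iff_eq_zero_or_one]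
      simp [h2, M.index_ne_zero_of_finite]
    rw [← M.card_mul_index, cardFactors_mul Nat.card_pos.ne' M.index_ne_zero_of_finite] at hG
    rw [← cardFactors_eq_one_iff_prime]
    omega
  have h := card_le_cardFactors_closure (fun i => (g i : G ⧸ N)) Finset.univ fun i _ hi => by
    apply hg i
    have hmap : Subgroup.closure ((fun i => (g i : G ⧸ N)) '' {j | j ∈ Finset.univ ∧ j ≠ i}) =
        (Subgroup.closure (g '' {j | j ≠ i})).map (QuotientGroup.mk' N) := by
      rw [MonoidHom.map_closure, Set.image_image]
      simp
    rw [hmap] at hi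
    have h' : g i ∈ ((Subgroup.closure (g '' {j | j ≠ i})).map (QuotientGroup.mk' N)).comap
        (QuotientGroup.mk' N) := hi
    rwa [Subgroup.comap_map_eq, QuotientGroup.ker_mk', sup_eq_left.mpr (key i)] at h'
  have h' := h.trans (cardFactors_le_of_dvd Nat.card_pos.ne' (Subgroup.card_subgroup_dvd_card _))
  rw [Finset.card_univ, Fintype.card_fin, ← Subgroup.index_eq_card] at h'
  omega

theorem Subgroup.relIndex_sup_left_of_le_normalizer {H N : Subgroup G}
    (h : H ≤ Subgroup.normalizer N) : N.relIndex (N ⊔ H) = N.relIndex H := by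
  let := Subgroup.normal_subgroupOf_of_le_normalizer h
  let := Subgroup.normal_subgroupOf_sup_of_le_normalizer h
  rw [sup_comm]
  exact Nat.card_congr (QuotientGroup.quotientInfEquivProdNormalizerQuotient H N h).toEquiv.symm

theorem Subgroup.card_sup_dvd_of_le_normalizer {H N : Subgroup G}
    (h : H ≤ Subgroup.normalizer N) : Nat.card ↥(N ⊔ H) ∣ Nat.card N * Nat.card H := by
  have h1 := Subgroup.card_mul_index (N.subgroupOf (N ⊔ H))
  rw [Nat.card_congr (Subgroup.subgroupOfEquivOfLe le_sup_left).toEquiv] at h1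
  rw [← h1]
  refine Nat.mul_dvd_mul_left _ ?_
  change N.relIndex (N ⊔ H) ∣ _
  rw [Subgroup.relIndex_sup_left_of_le_normalizer h]
  exact Subgroup.relIndex_dvd_card _ _

end Irredundance

section Structure

variable {p q : ℕ}

/-- Translations as a homomorphism from the additive group of `V`. -/
def translationHom (q p : ℕ) : Multiplicative (Vqp q p) →* Equiv.Perm (Vqp q p) where
  toFun v := Equiv.addLeft v.toAdd
  map_one' := by ext; simp
  map_mul' a b := by ext; simp

theorem translationHom_injective : Function.Injective (translationHom q p) := by
  intro a b h
  have := DFunLike.congr_fun h 0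
  simpa [translationHom] using this

theorem range_translationHom : (translationHom q p).range = Vtrans q p := by
  have : (Set.range fun v : Vqp q p => Equiv.addLeft v) = ((translationHom q p).range : Set _) :=
    rfl
  rw [Vtrans, this, Subgroup.closure_eq]

theorem mem_Vtrans {f : Equiv.Perm (Vqp q p)} : f ∈ Vtrans q p ↔ ∃ v, Equiv.addLeft v = f := by
  rw [← range_translationHom]
  rfl

theorem card_Vtrans : Nat.card (Vtrans q p) = q ^ p := by
  rw [← range_translationHom,
    ← Nat.card_congr (MonoidHom.ofInjective translationHom_injective).toEquiv]
  change Nat.card (Fin p → ZMod q) = _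
  rw [Nat.card_fun, Nat.card_zmod, Nat.card_fin]

@[simp]
theorem coordPerm_apply (e : Equiv.Perm (Fin p)) (x : Vqp q p) (j : Fin p) :
    coordPerm q p e x j = x (e.symm j) := rfl

variable [Fact q.Prime] {c : (ZMod q)ˣ}

@[simp]
theorem scalePerm_apply (i j : Fin p) (x : Vqp q p) :
    scalePerm q p c i x j = if j = i then (c : ZMod q) * x j else x j := by
  change (if j = i then Equiv.mulLeft₀ (c : ZMod q) c.ne_zero else Equiv.refl _) (x j) = _
  split_ifs <;> rfl

theorem map_add_of_mem_Hqp {f : Equiv.Perm (Vqp q p)} (hf : f ∈ Hqp q p c) (x y : Vqp q p) :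
    f (x + y) = f x + f y := by
  induction hf using Subgroup.closure_induction generalizing x y with
  | mem f hf =>
    rcases hf with ⟨i, rfl⟩ | rfl
    · ext j
      simp only [scalePerm_apply, Pi.add_apply]
      split_ifs <;> ring
    · ext j
      simp
  | one => rfl
  | mul f g _ _ hf hg => simp [hf, hg]
  | inv f _ hf => rw [Equiv.Perm.inv_eq_iff_eq, hf]; simp

theorem conj_addLeft_of_mem_Hqp {f : Equiv.Perm (Vqp q p)} (hf : f ∈ Hqp q p c) (v : Vqp q p) :
    f * Equiv.addLeft v * f⁻¹ = Equiv.addLeft (f v) := by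
  ext x : 1
  simp [map_add_of_mem_Hqp hf]

theorem Hqp_le_normalizer : Hqp q p c ≤ Subgroup.normalizer (Vtrans q p) := by
  rw [Subgroup.le_normalizer_iff]
  intro f hf t ht
  obtain ⟨v, rfl⟩ := mem_Vtrans.mp ht
  rw [conj_addLeft_of_mem_Hqp hf]
  exact mem_Vtrans.mpr ⟨_, rfl⟩

theorem Gqp_le_normalizer : Gqp q p c ≤ Subgroup.normalizer (Vtrans q p) :=
  sup_le Subgroup.le_normalizer Hqp_le_normalizer

theorem coordPerm_mul_scalePerm_mul_inv (e : Equiv.Perm (Fin p)) (i : Fin p) :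
    coordPerm q p e * scalePerm q p c i * (coordPerm q p e)⁻¹ = scalePerm q p c (e i) := by
  rw [mul_inv_eq_iff_eq_mul]
  ext x j
  simp [Equiv.symm_apply_eq]

theorem card_closure_scalePerm_dvd :
    Nat.card (Subgroup.closure (Set.range (scalePerm q p c))) ∣ orderOf c ^ p := by
  let f := MulAction.toPermHom (Fin p → Subgroup.zpowers c) (Vqp q p)
  have hle : Subgroup.closure (Set.range (scalePerm q p c)) ≤ f.range := by
    rw [Subgroup.closure_le]
    rintro _ ⟨i, rfl⟩
    refine ⟨Pi.mulSingle i ⟨c, Subgroup.mem_zpowers c⟩, ?_⟩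
    ext x j
    rw [scalePerm_apply]
    change (Pi.mulSingle i (⟨c, Subgroup.mem_zpowers c⟩ : Subgroup.zpowers c) : _ → _) j • x j = _
    by_cases h : j = i
    · subst h
      simp [Subgroup.smul_def, Units.smul_def]
    · simp [h]
  refine (Subgroup.card_dvd_of_le hle).trans ((Subgroup.card_range_dvd f).trans ?_)
  rw [Nat.card_pi, Finset.prod_const, Finset.card_univ, Fintype.card_fin, Nat.card_zpowers]

theorem card_Hqp_dvd (hp : 2 ≤ p) : Nat.card (Hqp q p c) ∣ orderOf c ^ p * p := by
  rw [Hqp, Subgroup.closure_union]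
  refine (Subgroup.card_sup_dvd_of_le_normalizer ?_).trans
    (Nat.mul_dvd_mul card_closure_scalePerm_dvd ?_)
  · rw [← Subgroup.zpowers_eq_closure, Subgroup.zpowers_le, Subgroup.mem_normalizer_iff_map_conj_eq,
      MonoidHom.map_closure, ← Set.range_comp,
      ← (finRotate p).surjective.range_comp (scalePerm q p c)]
    congr 2
    exact funext fun i => coordPerm_mul_scalePerm_mul_inv _ i
  · rw [← Subgroup.zpowers_eq_closure, Nat.card_zpowers, orderOf_dvd_iff_pow_eq_one]
    have hpow (k : ℕ) : coordPerm q p (finRotate p) ^ k = coordPerm q p (finRotate p ^ k) := by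
      induction k with
      | zero => rfl
      | succ k ih => rw [pow_succ, pow_succ, ih]; rfl
    obtain ⟨n, rfl⟩ := Nat.exists_eq_add_of_le' hp
    have hrot : finRotate (n + 2) ^ (n + 2) = 1 := by
      have := (isCycle_finRotate (n := n)).orderOf
      rw [support_finRotate, Finset.card_univ, Fintype.card_fin] at this
      simpa only [this] using pow_orderOf_eq_one (finRotate (n + 2))
    rw [hpow, hrot]
    rfl

/-- A nonzero `H`-invariant additive subgroup of `V` is everything. -/
theorem eq_top_of_Hqp_invariant (hp : 2 ≤ p) (hc : c ≠ 1) {W : AddSubgroup (Vqp q p)}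
    (hW : ∀ f ∈ Hqp q p c, ∀ v ∈ W, f v ∈ W) (hne : W ≠ ⊥) : W = ⊤ := by
  obtain ⟨w, hw, hw0⟩ := W.bot_or_exists_ne_zero.resolve_left hne
  obtain ⟨i, hi⟩ := Function.ne_iff.mp hw0
  have hscale : Pi.single i (((c : ZMod q) - 1) * w i) ∈ W := by
    have := W.sub_mem (hW _ (Subgroup.subset_closure (Or.inl ⟨i, rfl⟩)) w hw) hw
    convert this using 1
    ext j
    by_cases h : j = i
    · subst h
      simp [sub_mul]
    · simp [h]
  set a := ((c : ZMod q) - 1) * w i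
  have ha : a ≠ 0 := mul_ne_zero (sub_ne_zero.mpr (by simpa using hc)) hi
  have hrot (k : ℕ) : Pi.single ((finRotate p ^ k) i) a ∈ W := by
    induction k with
    | zero => exact hscale
    | succ k ih =>
      convert hW _ (Subgroup.subset_closure (Or.inr rfl)) _ ih using 1
      ext j
      rw [coordPerm_apply, Pi.single_apply, Pi.single_apply, pow_succ',
        Equiv.Perm.mul_apply]
      simp only [Equiv.symm_apply_eq]
  have hall (j : Fin p) : ∃ k : ℕ, (finRotate p ^ k) i = j := by
    obtain ⟨n, rfl⟩ := Nat.exists_eq_add_of_le' hp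
    exact (isCycle_finRotate (n := n)).exists_pow_eq (by simp) (by simp)
  have hsingle (j : Fin p) (t : ZMod q) : Pi.single j t ∈ W := by
    obtain ⟨k, rfl⟩ := hall j
    have := W.nsmul_mem (hrot k) (t * a⁻¹).val
    convert this using 1
    rw [← Pi.single_smul', nsmul_eq_mul, ZMod.natCast_zmod_val, mul_assoc, inv_mul_cancel₀ ha,
      mul_one]
  rw [eq_top_iff]
  intro v _
  rw [← Finset.univ_sum_single v]
  exact W.sum_mem fun j _ => hsingle j _

/-- Every subgroup of prime index of `G_{q,p}` contains the translations. -/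
theorem Vtrans_le_of_prime_index (hp : 2 ≤ p) (hc : c ≠ 1) (M : Subgroup (Gqp q p c))
    (hM : M.index.Prime) : (Vtrans q p).subgroupOf (Gqp q p c) ≤ M := by
  set N := (Vtrans q p).subgroupOf (Gqp q p c) with hNdef
  have : N.Normal := (Subgroup.normal_subgroupOf_iff_le_normalizer le_sup_left).mpr
    Gqp_le_normalizer
  by_contra hNM
  have hcardN : Nat.card N = q ^ p := by
    rw [hNdef, Nat.card_congr (Subgroup.subgroupOfEquivOfLe (H := Vtrans q p) (K := Gqp q p c)
      le_sup_left).toEquiv, card_Vtrans]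
  have hrel := Subgroup.relIndex_mul_index (le_sup_left : M ≤ M ⊔ N)
  have htop : M ⊔ N = ⊤ := by
    rw [← Subgroup.index_eq_one]
    refine (hM.eq_one_or_self_of_dvd _ (Dvd.intro_left _ hrel)).resolve_right fun h => ?_
    rw [h] at hrel
    have h1 := Nat.eq_of_mul_eq_mul_right hM.pos (hrel.trans (one_mul _).symm)
    exact hNM (le_sup_right.trans (Subgroup.relIndex_eq_one.mp h1))
  have hT (v : Vqp q p) : Equiv.addLeft v ∈ Gqp q p c :=
    Subgroup.mem_sup_left (mem_Vtrans.mpr ⟨v, rfl⟩)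
  let W : AddSubgroup (Vqp q p) :=
    { carrier := {v | (⟨Equiv.addLeft v, hT v⟩ : Gqp q p c) ∈ M}
      zero_mem' := by
        change _ ∈ M
        convert M.one_mem using 1
        ext; simp
      add_mem' := fun {a b} ha hb => by
        change _ ∈ M
        convert M.mul_mem ha hb using 1
        ext; simp
      neg_mem' := fun {a} ha => by
        change _ ∈ M
        convert M.inv_mem ha using 1
        ext; simp }
  have hW : ∀ f ∈ Hqp q p c, ∀ v ∈ W, f v ∈ W := by
    intro f hf v hv
    have hfG : f ∈ Gqp q p c := Subgroup.mem_sup_right hf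
    obtain ⟨m, hm, t, ht, hmt⟩ := Subgroup.mem_sup_of_normal_right.mp
      (htop ▸ Subgroup.mem_top (⟨f, hfG⟩ : Gqp q p c))
    obtain ⟨u, hu⟩ := mem_Vtrans.mp (Subgroup.mem_subgroupOf.mp ht)
    have hmem := M.mul_mem (M.mul_mem hm hv) (M.inv_mem hm)
    change _ ∈ M
    convert hmem using 1
    have hm' : m = ⟨f, hfG⟩ * t⁻¹ := by rw [← hmt]; group
    ext1
    rw [hm']
    change Equiv.addLeft (f v) = f * (t : Equiv.Perm (Vqp q p))⁻¹ * Equiv.addLeft v *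
      (f * (t : Equiv.Perm (Vqp q p))⁻¹)⁻¹
    rw [← conj_addLeft_of_mem_Hqp hf, ← hu]
    have hcomm : (Equiv.addLeft u)⁻¹ * Equiv.addLeft v * Equiv.addLeft u = Equiv.addLeft v := by
      ext x : 1
      simp [← add_assoc]
    rw [mul_inv_rev, inv_inv]
    conv_lhs => rw [← hcomm]
    group
  rcases eq_or_ne W ⊥ with hbot | hne
  · have hinf : M ⊓ N = ⊥ := by
      rw [eq_bot_iff]
      rintro ⟨x, hx⟩ ⟨hxM, hxN⟩
      obtain ⟨v, rfl⟩ := mem_Vtrans.mp (Subgroup.mem_subgroupOf.mp hxN)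
      have hv : v ∈ W := hxM
      rw [hbot, AddSubgroup.mem_bot] at hv
      subst hv
      rw [Subgroup.mem_bot]
      ext; simp
    have hidx : M.index = q ^ p := by
      have h1 := Subgroup.card_mul_index M
      have h2 := Subgroup.card_mul_index N
      have h3 : N.index = Nat.card M := by
        have := Subgroup.relIndex_sup_right (H := M) (K := N)
        rw [htop, Subgroup.relIndex_top_right] at this
        rw [this, ← Subgroup.inf_relIndex_left, hinf, Subgroup.relIndex_bot_left]
      rw [h3, ← h1, mul_comm, hcardN] at h2
      exact (Nat.eq_of_mul_eq_mul_left Nat.card_pos h2).symm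
    rw [hidx] at hM
    exact Nat.Prime.not_prime_pow hp hM
  · apply hNM
    rintro ⟨x, hx⟩ hxN
    obtain ⟨v, rfl⟩ := mem_Vtrans.mp (Subgroup.mem_subgroupOf.mp hxN)
    have hv : v ∈ W := eq_top_of_Hqp_invariant hp hc hW hne ▸ AddSubgroup.mem_top v
    exact hv

theorem exists_irredundant_Gqp (hc : c ≠ 1) :
    ∃ g : Fin (2 * p) → Gqp q p c, Irredundant g := by
  let t (i : Fin p) : Gqp q p c := ⟨Equiv.addLeft (Pi.single i 1),
    Subgroup.mem_sup_left (mem_Vtrans.mpr ⟨_, rfl⟩)⟩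
  let s (i : Fin p) : Gqp q p c := ⟨scalePerm q p c i,
    Subgroup.mem_sup_right (Subgroup.subset_closure (Or.inl ⟨i, rfl⟩))⟩
  let e : Fin (2 * p) ≃ Fin p ⊕ Fin p := (finCongr (two_mul p)).trans finSumFinEquiv.symm
  refine ⟨Sum.elim t s ∘ e, irredundant_iff_notMem.mpr fun k hk => ?_⟩
  have himage : (Sum.elim t s ∘ e) '' {j | j ≠ k} ⊆ Sum.elim t s '' {j | j ≠ e k} := by
    rintro _ ⟨j, hj, rfl⟩
    exact ⟨e j, by simpa using hj, rfl⟩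
  replace hk := Subgroup.closure_mono himage hk
  simp only [Function.comp_apply] at hk
  generalize e k = x at hk
  rcases x with i | i
  · have hfix : ∀ f ∈ Subgroup.closure (Sum.elim t s '' {j | j ≠ Sum.inl i}),
        ∀ x : Vqp q p, (f : Equiv.Perm (Vqp q p)) x i = 0 ↔ x i = 0 := by
      intro f hf
      induction hf using Subgroup.closure_induction with
      | mem f hf =>
        obtain ⟨j | j, hj, rfl⟩ := hf <;> intro x
        · have hji : i ≠ j := fun h => hj (h ▸ rfl)
          simp [t, hji]
        · simp only [Sum.elim_inr, s, scalePerm_apply]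
          split_ifs <;> simp
      | one => exact fun _ => Iff.rfl
      | mul f g _ _ hf hg => exact fun x => (hf _).trans (hg x)
      | inv f _ hf =>
        intro x
        rw [← hf]
        simp
    simpa [t] using hfix _ hk 0
  · have hfix : ∀ f ∈ Subgroup.closure (Sum.elim t s '' {j | j ≠ Sum.inr i}),
        ∀ x y : Vqp q p, (f : Equiv.Perm (Vqp q p)) x i - (f : Equiv.Perm (Vqp q p)) y i =
          x i - y i := by
      intro f hf
      induction hf using Subgroup.closure_induction with
      | mem f hf =>
        obtain ⟨j | j, hj, rfl⟩ := hf <;> intro x y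
        · simp [t]
        · have hji : i ≠ j := fun h => hj (h ▸ rfl)
          simp [s, hji]
      | one => exact fun _ _ => rfl
      | mul f g _ _ hf hg => exact fun x y => (hf _ _).trans (hg x y)
      | inv f _ hf =>
        intro x y
        rw [← hf]
        simp
    have := hfix _ hk (Pi.single i 1) 0
    simp only [Sum.elim_inr, s, scalePerm_apply] at this
    exact hc (by simpa using this)

end Structure

/-- Proposition 6: `i(G_{q,p}) = 2p`. -/
theorem i_Gqp_eq_two_mul (p q : ℕ) [Fact p.Prime] [Fact q.Prime] (hpq : p ∣ q - 1)
    (c : (ZMod q)ˣ) (hc : orderOf c = p) :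
    iInv ↥(Gqp q p c) = 2 * p := by
  have hp : p.Prime := Fact.out
  have hq : q.Prime := Fact.out
  have hc1 : c ≠ 1 := by
    rintro rfl
    exact hp.ne_one (hc ▸ orderOf_one)
  have hcardH : cardFactors (Nat.card (Hqp q p c)) ≤ p + 1 := by
    have := cardFactors_le_of_dvd (by rw [hc]; exact mul_ne_zero (pow_ne_zero _ hp.ne_zero) hp.ne_zero)
      (card_Hqp_dvd (c := c) hp.two_le)
    rwa [hc, ← pow_succ, cardFactors_apply_prime_pow hp] at this
  have hcardV : cardFactors (Nat.card (Vtrans q p)) = p := by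
    rw [card_Vtrans, cardFactors_apply_prime_pow hq]
  set N := (Vtrans q p).subgroupOf (Gqp q p c)
  have : N.Normal := (Subgroup.normal_subgroupOf_iff_le_normalizer le_sup_left).mpr
    Gqp_le_normalizer
  have hcardG : cardFactors (Nat.card (Gqp q p c)) ≤ 2 * p + 1 := by
    have := cardFactors_le_of_dvd (mul_ne_zero Nat.card_pos.ne' Nat.card_pos.ne')
      (Subgroup.card_sup_dvd_of_le_normalizer (Hqp_le_normalizer (q := q) (p := p) (c := c)))
    rw [cardFactors_mul Nat.card_pos.ne' Nat.card_pos.ne'] at this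
    change cardFactors (Nat.card (Gqp q p c)) ≤ _ at this
    omega
  have hindex : cardFactors N.index < 2 * p + 1 := by
    have : N.index ∣ Nat.card (Hqp q p c) := by
      change (Vtrans q p).relIndex (Vtrans q p ⊔ Hqp q p c) ∣ _
      rw [Subgroup.relIndex_sup_left_of_le_normalizer Hqp_le_normalizer]
      exact Subgroup.relIndex_dvd_card _ _
    have := cardFactors_le_of_dvd Nat.card_pos.ne' this
    have := hp.two_le
    omega
  have hgreatest : IsGreatest {n | ∃ g : Fin n → Gqp q p c, Irredundant g} (2 * p) :=
    ⟨exists_irredundant_Gqp hc1, fun n ⟨g, hg⟩ => Nat.lt_succ_iff.mp <|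
      hg.lt_of_prime_index hcardG hindex (Vtrans_le_of_prime_index hp.two_le hc1)⟩
  exact hgreatest.csSup_eq
end
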